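/- Let v be an odd integer with v ≥ 5, and suppose there exists a pairwise balanced design PBD(v,{5,7,9}) (index 1). Then there exists a threefold triple system TS_3(v) whose generalized incidence matrix N_2 is square of order v(v-1)/2 and nonsingular over the rationals. -/

import Mathlib

open Finset

/-- `IsPBD B lam K`: the indexed family of blocks `B` (a multiset of subsets of the
point set `V`, one block per index) is a pairwise balanced design `PBD_lam(|V|, K)`:
every block has size in `K`, and every pair of distinct points lies in exactly `lam`
blocks (counted with multiplicity). -/
def IsPBD {V : Type*} [DecidableEq V] {ι : Type*} [Fintype ι]
    (B : ι → Finset V) (lam : ℕ) (K : Set ℕ) : Prop :=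
  (∀ i, (B i).card ∈ K) ∧
  (∀ p : Finset V, p.card = 2 → (Finset.univ.filter (fun i => p ⊆ B i)).card = lam)

/-- The generalized incidence matrix `N₂`: rows indexed by 2-element subsets of the
point set, columns indexed by the blocks (with multiplicity); entry is 1 if the pair
is contained in the block, and 0 otherwise. -/
def N2 {V : Type*} [DecidableEq V] {ι : Type*} (F : Type*) [Zero F] [One F]
    (B : ι → Finset V) : Matrix {P : Finset V // P.card = 2} ι F :=
  Matrix.of fun P i => if (P : Finset V) ⊆ B i then 1 else 0

/-- The point set `S` carries a (simple) threefold triple system whose pair-by-block incidence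
matrix has linearly independent rows: only the zero weighting of the pairs in `S` sums to zero
over every block. -/
def HasNonsingularTS3 {V : Type*} [DecidableEq V] (S : Finset V) : Prop :=
  ∃ D : Finset (Finset V),
    (∀ t ∈ D, t.card = 3 ∧ t ⊆ S) ∧
    (∀ p ∈ S.powersetCard 2, (D.filter (p ⊆ ·)).card = 3) ∧
    ∀ g : Finset V → ℚ, (∀ t ∈ D, ∑ p ∈ t.powersetCard 2, g p = 0) →
      ∀ p ∈ S.powersetCard 2, g p = 0

theorem sum_powersetCard_two_triple {V M : Type*} [DecidableEq V] [AddCommMonoid M]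
    (g : Finset V → M) {a b c : V} (hab : a ≠ b) (hac : a ≠ c) (hbc : b ≠ c) :
    ∑ p ∈ powersetCard 2 {a, b, c}, g p = g {a, b} + g {a, c} + g {b, c} := by
  have h : powersetCard 2 ({a, b, c} : Finset V) = {{a, b}, {a, c}, {b, c}} := by
    rw [powersetCard_succ_insert (by simp [hab, hac]), powersetCard_succ_insert (by simpa using hbc),
      powersetCard_one, powersetCard_one]
    ext p
    simp only [map_singleton, map_insert, image_singleton, image_insert, mem_union, mem_insert,
      mem_singleton, Function.Embedding.coeFn_mk, mem_powersetCard, subset_singleton_iff]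
    constructor
    · rintro ((⟨rfl | rfl, h⟩ | h) | h | h) <;> simp_all
    · tauto
  have hne {x y z w : V} (u : V) (hu : u ∈ ({x, y} : Finset V)) (hu' : u ∉ ({z, w} : Finset V)) :
      ({x, y} : Finset V) ≠ {z, w} := fun e => hu' (e ▸ hu)
  have h₁ : ({a, b} : Finset V) ≠ {a, c} := hne b (by simp) (by simp [hab.symm, hbc])
  have h₂ : ({a, b} : Finset V) ≠ {b, c} := hne a (by simp) (by simp [hab, hac])
  have h₃ : ({a, c} : Finset V) ≠ {b, c} := hne a (by simp) (by simp [hab, hac])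
  rw [h, sum_insert (by simp [h₁, h₂]), sum_insert (by simp [h₃]), sum_singleton, add_assoc]

/-- A criterion with an explicit list `Q` of the pairs of points. -/
theorem hasNonsingularTS3_univ_of_cover {V : Type*} [DecidableEq V] [Fintype V]
    (D Q : Finset (Finset V)) (hD : ∀ t ∈ D, t.card = 3)
    (hQ : powersetCard 2 univ ⊆ Q) (hcount : ∀ p ∈ Q, (D.filter (p ⊆ ·)).card = 3)
    (hinj : ∀ g : Finset V → ℚ, (∀ t ∈ D, ∑ p ∈ t.powersetCard 2, g p = 0) →
      ∀ p ∈ Q, g p = 0) :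
    HasNonsingularTS3 (univ : Finset V) :=
  ⟨D, fun t ht => ⟨hD t ht, subset_univ t⟩, fun p hp => hcount p (hQ hp),
    fun g hg p hp => hinj g hg p (hQ hp)⟩

theorem hasNonsingularTS3_univ_fin_five :
    HasNonsingularTS3 (univ : Finset (Fin 5)) := by
  refine hasNonsingularTS3_univ_of_cover
    {{0, 1, 2}, {0, 1, 3}, {0, 1, 4}, {0, 2, 3}, {0, 2, 4}, {0, 3, 4}, {1, 2, 3}, {1, 2, 4},
    {1, 3, 4}, {2, 3, 4}}
    {{0, 1}, {0, 2}, {0, 3}, {0, 4}, {1, 2}, {1, 3}, {1, 4}, {2, 3}, {2, 4}, {3, 4}}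
    (by decide +kernel) (by decide +kernel) (by decide +kernel) fun g hg => ?_
  simp only [forall_mem_insert, mem_singleton, forall_eq] at hg ⊢
  simp (decide := true) only [sum_powersetCard_two_triple, ne_eq] at hg
  casesm* _ ∧ _
  and_intros <;> linarith

theorem hasNonsingularTS3_univ_fin_seven :
    HasNonsingularTS3 (univ : Finset (Fin 7)) := by
  refine hasNonsingularTS3_univ_of_cover
    {{0, 1, 2}, {0, 1, 4}, {0, 1, 6}, {0, 2, 4}, {0, 2, 5}, {0, 3, 4}, {0, 3, 5}, {0, 3, 6},
    {0, 5, 6}, {1, 2, 3}, {1, 2, 5}, {1, 3, 5}, {1, 3, 6}, {1, 4, 5}, {1, 4, 6}, {2, 3, 4},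
    {2, 3, 6}, {2, 4, 6}, {2, 5, 6}, {3, 4, 5}, {4, 5, 6}}
    {{0, 1}, {0, 2}, {0, 3}, {0, 4}, {0, 5}, {0, 6}, {1, 2}, {1, 3}, {1, 4}, {1, 5}, {1, 6},
    {2, 3}, {2, 4}, {2, 5}, {2, 6}, {3, 4}, {3, 5}, {3, 6}, {4, 5}, {4, 6}, {5, 6}}
    (by decide +kernel) (by decide +kernel) (by decide +kernel) fun g hg => ?_
  simp only [forall_mem_insert, mem_singleton, forall_eq] at hg ⊢
  simp (decide := true) only [sum_powersetCard_two_triple, ne_eq] at hg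
  casesm* _ ∧ _
  and_intros <;> linarith

set_option maxHeartbeats 2000000 in
theorem hasNonsingularTS3_univ_fin_nine :
    HasNonsingularTS3 (univ : Finset (Fin 9)) := by
  refine hasNonsingularTS3_univ_of_cover
    {{0, 1, 2}, {0, 1, 3}, {0, 1, 7}, {0, 2, 5}, {0, 2, 6}, {0, 3, 6}, {0, 3, 8}, {0, 4, 5},
    {0, 4, 7}, {0, 4, 8}, {0, 5, 6}, {0, 7, 8}, {1, 2, 4}, {1, 2, 8}, {1, 3, 5}, {1, 3, 6},
    {1, 4, 6}, {1, 4, 7}, {1, 5, 7}, {1, 5, 8}, {1, 6, 8}, {2, 3, 4}, {2, 3, 5}, {2, 3, 7},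
    {2, 4, 8}, {2, 5, 7}, {2, 6, 7}, {2, 6, 8}, {3, 4, 5}, {3, 4, 8}, {3, 6, 7}, {3, 7, 8},
    {4, 5, 6}, {4, 6, 7}, {5, 6, 8}, {5, 7, 8}}
    {{0, 1}, {0, 2}, {0, 3}, {0, 4}, {0, 5}, {0, 6}, {0, 7}, {0, 8}, {1, 2}, {1, 3}, {1, 4},
    {1, 5}, {1, 6}, {1, 7}, {1, 8}, {2, 3}, {2, 4}, {2, 5}, {2, 6}, {2, 7}, {2, 8}, {3, 4},
    {3, 5}, {3, 6}, {3, 7}, {3, 8}, {4, 5}, {4, 6}, {4, 7}, {4, 8}, {5, 6}, {5, 7}, {5, 8},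
    {6, 7}, {6, 8}, {7, 8}}
    (by decide +kernel) (by decide +kernel) (by decide +kernel) fun g hg => ?_
  simp only [forall_mem_insert, mem_singleton, forall_eq] at hg ⊢
  simp (decide := true) only [sum_powersetCard_two_triple, ne_eq] at hg
  casesm* _ ∧ _
  and_intros <;> linarith

theorem HasNonsingularTS3.map {W V : Type*} [DecidableEq W] [DecidableEq V] {S : Finset W}
    (h : HasNonsingularTS3 S) (e : W ↪ V) : HasNonsingularTS3 (S.map e) := by
  obtain ⟨D, hD, hcount, hinj⟩ := h
  have hpair {p : Finset V} (hp : p ∈ (S.map e).powersetCard 2) :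
      ∃ q ∈ S.powersetCard 2, q.map e = p := by
    rw [powersetCard_map] at hp
    simpa using hp
  refine ⟨D.map (mapEmbedding e).toEmbedding, fun t ht => ?_, fun p hp => ?_, fun g hg p hp => ?_⟩
  · obtain ⟨s, hs, rfl⟩ := Finset.mem_map.1 ht
    simpa using hD s hs
  · obtain ⟨q, hq, rfl⟩ := hpair hp
    rw [filter_map, card_map, ← hcount q hq]
    congr 1
    ext t
    simp
  · obtain ⟨q, hq, rfl⟩ := hpair hp
    refine hinj (fun q => g (q.map e)) (fun t ht => ?_) q hq
    have := hg (t.map e) (Finset.mem_map.2 ⟨t, ht, rfl⟩)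
    rw [powersetCard_map, sum_map] at this
    simpa using this

theorem hasNonsingularTS3_of_card_mem {V : Type*} [DecidableEq V] {S : Finset V}
    (hS : S.card ∈ ({5, 7, 9} : Set ℕ)) : HasNonsingularTS3 S := by
  have h : HasNonsingularTS3 (univ : Finset (Fin S.card)) := by
    rcases hS with h | h | h
    · exact h ▸ hasNonsingularTS3_univ_fin_five
    · exact h ▸ hasNonsingularTS3_univ_fin_seven
    · rw [Set.mem_singleton_iff] at h
      exact h ▸ hasNonsingularTS3_univ_fin_nine
  have hmap := h.map (S.equivFin.symm.toEmbedding.trans (Function.Embedding.subtype _))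
  rwa [← map_map, map_univ_equiv, ← attach_eq_univ, attach_map_val] at hmap

theorem card_filter_sigma_finset {ι α : Type*} [Fintype ι] (D : ι → Finset α) (P : α → Prop)
    [DecidablePred P] :
    (univ.filter fun x : Σ i, D i => P x.2).card = ∑ i, ((D i).filter P).card := by
  simp only [card_filter, Fintype.sum_sigma]
  exact sum_congr rfl fun i _ => sum_coe_sort (D i) fun t => if P t then 1 else 0

theorem IsPBD.exists_triple_system.{u} {V : Type u} [DecidableEq V] [Fintype V] {n : ℕ} {K : Set ℕ}
    {A : Fin n → Finset V} (hA : IsPBD A 1 K) (hS : ∀ i, HasNonsingularTS3 (A i)) :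
    ∃ (κ : Type u) (_ : Fintype κ) (B : κ → Finset V),
      IsPBD B 3 {3} ∧ LinearIndependent ℚ (N2 ℚ B).row := by
  choose D hD hcount hinj using hS
  refine ⟨Σ i, {t // t ∈ D i}, inferInstance, fun x => x.2,
    ⟨fun x => (hD x.1 _ x.2.2).1, fun p hp => ?_⟩, ?_⟩
  · have hlocal (i : Fin n) : ((D i).filter (p ⊆ ·)).card = if p ⊆ A i then 3 else 0 := by
      split_ifs with h
      · exact hcount i p (mem_powersetCard.2 ⟨h, hp⟩)
      · rw [card_eq_zero, filter_eq_empty_iff]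
        exact fun t ht hpt => h (hpt.trans (hD i t ht).2)
    rw [card_filter_sigma_finset D (p ⊆ ·), sum_congr rfl fun i _ => hlocal i, ← sum_filter,
      sum_const, hA.2 p hp, one_smul]
  · refine Fintype.linearIndependent_iff.2 fun w hw P => ?_
    let g : Finset V → ℚ := fun p => if h : p.card = 2 then w ⟨p, h⟩ else 0
    obtain ⟨i, hi⟩ : (univ.filter fun i => (P : Finset V) ⊆ A i).Nonempty := by
      rw [← card_pos, hA.2 P P.2]
      exact one_pos
    have hP : g P = 0 := by
      refine hinj i g (fun t ht => ?_) P (mem_powersetCard.2 ⟨(mem_filter.1 hi).2, P.2⟩)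
      have hsum := congrFun hw ⟨i, t, ht⟩
      simp only [N2, Matrix.row, Finset.sum_apply, Pi.smul_apply, Matrix.of_apply, smul_eq_mul,
        mul_ite, mul_one, mul_zero, Pi.zero_apply] at hsum
      rw [← hsum, ← sum_filter]
      symm
      refine sum_bij (fun Q _ => (Q : Finset V)) ?_ ?_ ?_ ?_
      · exact fun Q hQ => mem_powersetCard.2 ⟨(mem_filter.1 hQ).2, Q.2⟩
      · exact fun _ _ _ _ h => Subtype.ext h
      · exact fun q hq => ⟨⟨q, (mem_powersetCard.1 hq).2⟩,
          mem_filter.2 ⟨mem_univ _, (mem_powersetCard.1 hq).1⟩, rfl⟩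
      · exact fun Q _ => by simp [g, Q.2]
    simpa [g, P.2] using hP

/-- A threefold triple system has as many blocks as there are pairs of points. -/
theorem IsPBD.card_eq_choose_two {V κ : Type*} [DecidableEq V] [Fintype V] [Fintype κ]
    {B : κ → Finset V} (hB : IsPBD B 3 {3}) : Fintype.card κ = (Fintype.card V).choose 2 := by
  have h := sum_card_bipartiteAbove_eq_sum_card_bipartiteBelow
    (s := powersetCard 2 (univ : Finset V)) (t := (univ : Finset κ)) fun p i => p ⊆ B i
  have hpairs (i : κ) : (bipartiteBelow (fun p i => p ⊆ B i) (powersetCard 2 univ) i).card = 3 := by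
    have : bipartiteBelow (fun p i => p ⊆ B i) (powersetCard 2 univ) i = powersetCard 2 (B i) := by
      ext p
      simp [bipartiteBelow, mem_powersetCard, and_comm]
    rw [this, card_powersetCard, show (B i).card = 3 from hB.1 i]
    rfl
  rw [sum_congr rfl fun p hp => show (bipartiteAbove (fun p i => p ⊆ B i) univ p).card = 3 from
    hB.2 p (mem_powersetCard.1 hp).2, sum_congr rfl fun i _ => hpairs i] at h
  simp only [sum_const, card_powersetCard, card_univ, smul_eq_mul] at h
  omega

theorem IsPBD.comp_equiv {V ι κ : Type*} [DecidableEq V] [Fintype ι] [Fintype κ] {lam : ℕ}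
    {K : Set ℕ} {B : κ → Finset V} (hB : IsPBD B lam K) (e : ι ≃ κ) : IsPBD (B ∘ e) lam K := by
  refine ⟨fun i => hB.1 (e i), fun p hp => ?_⟩
  rw [← hB.2 p hp]
  exact card_equiv e (by simp)

/-- If `v ≥ 5` is odd and a `PBD(v, {5,7,9})` (index 1) exists, then there exists a
threefold triple system `TS_3(v)` whose generalized incidence matrix `N₂` is square of
order `v(v-1)/2` and nonsingular (i.e. of full rank) over the rationals. -/
theorem ts3_nonsingular_of_pbd579 (v : ℕ) (hv : 5 ≤ v) (hodd : Odd v)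
    (hPBD : ∃ (n : ℕ) (A : Fin n → Finset (Fin v)), IsPBD A 1 {5, 7, 9}) :
    ∃ B : Fin (v * (v - 1) / 2) → Finset (Fin v),
      IsPBD B 3 {3} ∧
      Fintype.card {P : Finset (Fin v) // P.card = 2} = v * (v - 1) / 2 ∧
      (N2 ℚ B).rank = v * (v - 1) / 2 := by
  obtain ⟨n, A, hA⟩ := hPBD
  obtain ⟨κ, _, B, hB, hind⟩ :=
    hA.exists_triple_system fun i => hasNonsingularTS3_of_card_mem (hA.1 i)
  have hpairs : Fintype.card {P : Finset (Fin v) // P.card = 2} = v * (v - 1) / 2 := by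
    rw [Fintype.card_finset_len, Fintype.card_fin, Nat.choose_two_right]
  have hκ : Fintype.card κ = v * (v - 1) / 2 := by
    rw [hB.card_eq_choose_two, Fintype.card_fin, Nat.choose_two_right]
  let e : Fin (v * (v - 1) / 2) ≃ κ := (Fintype.equivFinOfCardEq hκ).symm
  refine ⟨B ∘ e, hB.comp_equiv e, hpairs, ?_⟩
  have hrank : (N2 ℚ (B ∘ e)).rank = (N2 ℚ B).rank :=
    Matrix.rank_submatrix (N2 ℚ B) (Equiv.refl _) e
  rw [hrank, hind.rank_matrix, hpairs]
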